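/- Let R be a noetherian local ring, p a prime ideal, and L an R_p-module such that Ext^i_{R_p}(T, L) = 0 for all i > 0 and every R_p-module T of finite projective dimension. If L ≠ 0, then depth R_p − width_{R_p}(L) ≤ 0, where width_{R_p}(L) = inf{ i : Tor_i^{R_p}(R_p/pR_p, L) ≠ 0 }. -/

import Mathlib

open CategoryTheory IsLocalRing

universe u

noncomputable section

/-- Depth of a local ring: the supremum of lengths of regular sequences in the maximal ideal. -/
noncomputable def ringDepth (A : Type u) [CommRing A] [IsLocalRing A] : ℕ∞ :=
  sSup {c : ℕ∞ | ∃ rs : List A, c = rs.length ∧ (∀ x ∈ rs, x ∈ maximalIdeal A) ∧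
    RingTheory.Sequence.IsRegular A rs}

/-- Krull dimension of a module: the Krull dimension of its support. -/
noncomputable def moduleDim (R : Type u) [CommRing R] (M : Type u) [AddCommGroup M] [Module R M] :
    WithBot (WithTop ℕ) :=
  Order.krullDim (Module.support R M)

/-- A module is Gorenstein injective if it is a kernel in a complete exact complex of
injective modules which stays exact after applying `Hom(J, -)` for every injective `J`. -/
def IsGorensteinInjective (R : Type u) [CommRing R] (G : Type u) [AddCommGroup G] [Module R G] :
    Prop :=
  ∃ (I : ℤ → ModuleCat.{u} R) (d : ∀ n : ℤ, I n →ₗ[R] I (n - 1)),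
    (∀ n, Injective (I n)) ∧
    (∀ n : ℤ, Function.Exact (d n) (d (n - 1))) ∧
    (∀ J : ModuleCat.{u} R, Injective J → ∀ n : ℤ,
      Function.Exact (fun f : J →ₗ[R] I n => (d n).comp f)
        (fun f : J →ₗ[R] I (n - 1) => (d (n - 1)).comp f)) ∧
    Nonempty (G ≃ₗ[R] LinearMap.ker (d 0))

/-- `HasGidLE R M n` : there is an exact sequence `0 → M → G⁰ → ⋯ → Gⁿ → 0`
with all `Gⁱ` Gorenstein injective. -/
def HasGidLE (R : Type u) [CommRing R] (M : Type u) [AddCommGroup M] [Module R M] (n : ℕ) : Prop :=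
  ∃ (G : ℕ → ModuleCat.{u} R) (e : M →ₗ[R] G 0) (d : ∀ i : ℕ, G i →ₗ[R] G (i + 1)),
    (∀ i, IsGorensteinInjective R (G i)) ∧
    Function.Injective e ∧
    Function.Exact e (d 0) ∧
    (∀ i, Function.Exact (d i) (d (i + 1))) ∧
    (∀ i, n < i → Subsingleton (G i))

/-- Gorenstein injective dimension. -/
noncomputable def Gid (R : Type u) [CommRing R] (M : Type u) [AddCommGroup M] [Module R M] :
    ℕ∞ :=
  sInf {c : ℕ∞ | ∃ n : ℕ, c = n ∧ HasGidLE R M n}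

/-- `HasInjDimLE R M n` : there is an exact sequence `0 → M → I⁰ → ⋯ → Iⁿ → 0`
with all `Iⁱ` injective. -/
def HasInjDimLE (R : Type u) [CommRing R] (M : Type u) [AddCommGroup M] [Module R M] (n : ℕ) :
    Prop :=
  ∃ (I : ℕ → ModuleCat.{u} R) (e : M →ₗ[R] I 0) (d : ∀ i : ℕ, I i →ₗ[R] I (i + 1)),
    (∀ i, Injective (I i)) ∧
    Function.Injective e ∧
    Function.Exact e (d 0) ∧
    (∀ i, Function.Exact (d i) (d (i + 1))) ∧
    (∀ i, n < i → Subsingleton (I i))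

/-- Injective dimension. -/
noncomputable def injDim (R : Type u) [CommRing R] (M : Type u) [AddCommGroup M] [Module R M] :
    ℕ∞ :=
  sInf {c : ℕ∞ | ∃ n : ℕ, c = n ∧ HasInjDimLE R M n}

/-- `HasProjDimLE R M n` : there is an exact sequence `0 → Pₙ → ⋯ → P₀ → M → 0`
with all `Pᵢ` projective. -/
def HasProjDimLE (R : Type u) [CommRing R] (M : Type u) [AddCommGroup M] [Module R M] (n : ℕ) :
    Prop :=
  ∃ (P : ℕ → ModuleCat.{u} R) (e : P 0 →ₗ[R] M) (d : ∀ i : ℕ, P (i + 1) →ₗ[R] P i),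
    (∀ i, Projective (P i)) ∧
    Function.Surjective e ∧
    Function.Exact (d 0) e ∧
    (∀ i, Function.Exact (d (i + 1)) (d i)) ∧
    (∀ i, n < i → Subsingleton (P i))

/-- Width of a module over a local ring: `inf { i | Torᵢ(k, L) ≠ 0 }`. -/
noncomputable def moduleWidth (A : Type u) [CommRing A] [IsLocalRing A] (L : Type u)
    [AddCommGroup L] [Module A L] : ℕ∞ :=
  sInf {c : ℕ∞ | ∃ i : ℕ, c = i ∧
    ¬ Subsingleton (((Tor (ModuleCat.{u} A) i).obj
      (ModuleCat.of A (ResidueField A))).obj (ModuleCat.of A L))}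

section ExtVanishing

variable {A : Type u} [CommRing A]

lemma HasProjDimLE.of_hasProjectiveDimensionLE (n : ℕ) (T : ModuleCat.{u} A)
    (h : HasProjectiveDimensionLE T n) : HasProjDimLE A T n := by
  induction n generalizing T with
  | zero =>
    have : Projective T := (projective_iff_hasProjectiveDimensionLE_zero T).2 h
    refine ⟨fun i ↦ Nat.rec T (fun _ _ ↦ ModuleCat.of A PUnit) i, LinearMap.id, fun _ ↦ 0,
      ?_, Function.surjective_id, ?_, ?_, ?_⟩
    · rintro (_ | i)
      · exact this
      · exact ModuleCat.projective_of_free (M := ModuleCat.of A PUnit)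
          (Module.Free.chooseBasis A PUnit.{u + 1})
    · intro y
      constructor
      · rintro rfl
        exact ⟨0, rfl⟩
      · rintro ⟨x, rfl⟩
        rfl
    · intro i y
      exact ⟨fun _ ↦ ⟨0, Subsingleton.elim (α := PUnit) _ _⟩, fun _ ↦ rfl⟩
    · rintro (_ | i) hi
      · exact absurd hi (lt_irrefl _)
      · exact inferInstanceAs (Subsingleton PUnit)
  | succ n ih =>
    let f : (T →₀ A) →ₗ[A] T := Finsupp.linearCombination A id
    have f_surj : Function.Surjective f := Finsupp.linearCombination_id_surjective A T
    have hS := LinearMap.shortExact_shortComplexKer f_surj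
    have hP : Projective (ModuleCat.of A (T →₀ A)) := ModuleCat.projective_of_free
      (Finsupp.basisSingleOne (R := A) (ι := T))
    have hK : HasProjectiveDimensionLE (ModuleCat.of A (LinearMap.ker f)) n :=
      (hS.hasProjectiveDimensionLT_X₃_iff n hP).1 h
    obtain ⟨Q, e, d, hQ, e_surj, hde, hdd, hn⟩ := ih _ hK
    refine ⟨fun i ↦ Nat.casesOn i (ModuleCat.of A (T →₀ A)) Q, f,
      fun i ↦ Nat.casesOn i ((LinearMap.ker f).subtype ∘ₗ e) d, ?_, f_surj, ?_, ?_, ?_⟩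
    · rintro (_ | i)
      · exact hP
      · exact hQ i
    · intro y
      constructor
      · intro hy
        obtain ⟨q, hq⟩ := e_surj ⟨y, hy⟩
        exact ⟨q, congrArg Subtype.val hq⟩
      · rintro ⟨q, rfl⟩
        exact (e q).2
    · rintro (_ | i)
      · intro y
        refine Iff.trans ?_ (hde y)
        exact Submodule.coe_eq_zero (x := e y)
      · exact hdd i
    · rintro (_ | i) hi
      · exact absurd hi (Nat.not_lt_zero _)
      · exact hn i (Nat.lt_of_succ_lt_succ hi)

lemma subsingleton_abelianExt_of_subsingleton_ext (T L : ModuleCat.{u} A) (n : ℕ)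
    (h : Subsingleton (((Ext A (ModuleCat.{u} A) (n + 1)).obj (Opposite.op T)).obj L)) :
    Subsingleton (Abelian.Ext T L (n + 1)) := by
  let P := ProjectiveResolution.of T
  have h_ex : (P.complex.linearYonedaObj A L).ExactAt (n + 1) := by
    rw [HomologicalComplex.exactAt_iff_isZero_homology]
    exact (ModuleCat.isZero_of_subsingleton _).of_iso (P.isoExt (n + 1) L).symm
  rw [HomologicalComplex.exactAt_iff' _ n (n + 1) (n + 2) (by simp) (by simp),
    ShortComplex.moduleCat_exact_iff] at h_ex
  refine subsingleton_of_forall_eq 0 fun α ↦ ?_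
  obtain ⟨f, hf, rfl⟩ := P.extMk_surjective α (n + 2) rfl
  rw [P.extMk_eq_zero_iff f (n + 2) rfl hf n rfl]
  exact h_ex f hf

/-- An element annihilating `N` annihilates `Ext M N i`. -/
lemma mk₀_smul_id_comp_eq_zero (M N : ModuleCat.{u} A) (x : A) (hx : ∀ y : N, x • y = 0) (i : ℕ)
    (e : Abelian.Ext M N i) :
    (Abelian.Ext.mk₀ (x • 𝟙 M)).comp e (zero_add i) = 0 := by
  have h0 : x • 𝟙 N = 0 := by
    ext y
    exact hx y
  rw [Abelian.Ext.mk₀_smul, Abelian.Ext.smul_comp, Abelian.Ext.mk₀_id_comp,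
    Abelian.Ext.smul_eq_comp_mk₀, h0]
  simp

/-- If multiplication by `x` on `M` is surjective with kernel `K`, and `x` annihilates `N`,
then vanishing of `Ext K N` below `n` gives vanishing of `Ext M N` below `n + 1`. -/
lemma subsingleton_ext_of_exact_smul {K M N : ModuleCat.{u} A} (x : A) (ι : K ⟶ M)
    (ι_inj : Function.Injective ι) (h_ex : Function.Exact ι (fun m : M ↦ x • m))
    (x_surj : Function.Surjective (fun m : M ↦ x • m)) (hx : ∀ y : N, x • y = 0) (n : ℕ)
    (hK : ∀ i < n, Subsingleton (Abelian.Ext K N i)) :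
    ∀ i < n + 1, Subsingleton (Abelian.Ext M N i) := by
  let S : ShortComplex (ModuleCat.{u} A) := ShortComplex.mk ι (x • 𝟙 M) (by
    ext k
    exact (h_ex (ι k)).2 ⟨k, rfl⟩)
  have hS : S.ShortExact :=
    { exact := (ShortComplex.ShortExact.moduleCat_exact_iff_function_exact _).2 h_ex
      mono_f := (ModuleCat.mono_iff_injective _).2 ι_inj
      epi_g := (ModuleCat.epi_iff_surjective _).2 x_surj }
  intro i hi
  refine subsingleton_of_forall_eq 0 fun e ↦ ?_
  have he : (Abelian.Ext.mk₀ S.g).comp e (zero_add i) = 0 :=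
    mk₀_smul_id_comp_eq_zero M N x hx i e
  cases i with
  | zero =>
    have := hS.epi_g
    refine Abelian.Ext.precomp_mk₀_injective_of_epi N S.g ?_
    rw [map_zero]
    exact he
  | succ i =>
    obtain ⟨e', rfl⟩ := Abelian.Ext.contravariant_sequence_exact₃ hS N e he (add_comm 1 i)
    have := hK i (by omega)
    rw [Subsingleton.elim e' 0, Abelian.Ext.comp_zero]

open Pointwise in
lemma subsingleton_ext_linearMap_of_isWeaklyRegular (L N : ModuleCat.{u} A)
    (hL : ∀ T : ModuleCat.{u} A, (∃ n, HasProjectiveDimensionLE T n) →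
      Subsingleton (Abelian.Ext T L 1))
    (rs : List A) (hN : ∀ x ∈ rs, ∀ y : N, x • y = 0) (T : ModuleCat.{u} A)
    (hT : ∃ n, HasProjectiveDimensionLE T n)
    (h_reg : RingTheory.Sequence.IsWeaklyRegular T rs) :
    ∀ i < rs.length, Subsingleton (Abelian.Ext (ModuleCat.of A (T →ₗ[A] L)) N i) := by
  induction rs generalizing T with
  | nil => exact fun i hi ↦ absurd hi (Nat.not_lt_zero i)
  | cons x rs ih =>
    rw [RingTheory.Sequence.isWeaklyRegular_cons_iff] at h_reg
    have hS := h_reg.1.smulShortComplex_shortExact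
    have hT' : ∃ n, HasProjectiveDimensionLE (T.smulShortComplex x).X₃ n := by
      obtain ⟨n, hn⟩ := hT
      exact ⟨n + 1, hS.hasProjectiveDimensionLT_X₃ (n + 1) hn
        (hasProjectiveDimensionLT_of_ge T (n + 1) (n + 2) (Nat.le_succ _))⟩
    have hK := ih (fun y hy ↦ hN y (List.mem_cons_of_mem _ hy)) (T.smulShortComplex x).X₃ hT'
      h_reg.2
    have h_ext := hL _ hT'
    have mkQ_surj := (x • (⊤ : Submodule A T)).mkQ_surjective
    refine subsingleton_ext_of_exact_smul x
      (ModuleCat.ofHom ((x • (⊤ : Submodule A T)).mkQ.lcomp A L)) ?_ ?_ ?_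
      (hN x List.mem_cons_self) rs.length hK
    · intro f g hfg
      refine LinearMap.ext fun q ↦ ?_
      obtain ⟨t, rfl⟩ := mkQ_surj q
      exact LinearMap.congr_fun hfg t
    · intro f
      constructor
      · intro hf
        refine ⟨(x • (⊤ : Submodule A T)).liftQ f ?_, LinearMap.ext fun t ↦ rfl⟩
        intro t ht
        obtain ⟨s, -, rfl⟩ := (Submodule.mem_smul_pointwise_iff_exists _ _ _).1 ht
        rw [LinearMap.mem_ker, map_smul]
        exact LinearMap.congr_fun hf s
      · rintro ⟨g, rfl⟩
        refine LinearMap.ext fun t ↦ ?_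
        change x • g ((x • (⊤ : Submodule A T)).mkQ t) = 0
        have h0 : (x • (⊤ : Submodule A T)).mkQ (x • t) = 0 :=
          (Submodule.Quotient.mk_eq_zero _).2 (Submodule.smul_mem_pointwise_smul t x ⊤ trivial)
        rw [← map_smul, ← map_smul, h0, map_zero]
    · intro f
      obtain ⟨e, he⟩ := Abelian.Ext.contravariant_sequence_exact₁ hS L
        (Abelian.Ext.mk₀ (ModuleCat.ofHom f)) (add_zero 1) (Subsingleton.elim _ _)
      obtain ⟨g, rfl⟩ := (Abelian.Ext.mk₀_bijective _ _).2 e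
      rw [Abelian.Ext.mk₀_comp_mk₀] at he
      have h_eq := (Abelian.Ext.mk₀_bijective _ _).1 he
      refine ⟨g.hom, LinearMap.ext fun t ↦ ?_⟩
      have ht := LinearMap.congr_fun (congrArg ModuleCat.Hom.hom h_eq) t
      exact (map_smul g.hom x t).symm.trans ht

open TensorProduct in
/-- If every `k`-valued cocycle at `M₂` is a coboundary, then `k ⊗ -` makes `M₁ → M₂ → M₃` exact. -/
lemma exists_lTensor_residueField_eq [IsLocalRing A] {M₁ M₂ M₃ : Type u} [AddCommGroup M₁]
    [AddCommGroup M₂] [AddCommGroup M₃] [Module A M₁] [Module A M₂] [Module A M₃]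
    (f : M₁ →ₗ[A] M₂) (g : M₂ →ₗ[A] M₃)
    (h : ∀ φ : M₂ →ₗ[A] ResidueField A, φ ∘ₗ f = 0 → ∃ ψ : M₃ →ₗ[A] ResidueField A, ψ ∘ₗ g = φ)
    (z : ResidueField A ⊗[A] M₂) (hz : g.lTensor (ResidueField A) z = 0) :
    ∃ w, f.lTensor (ResidueField A) w = z := by
  by_contra hw
  have hz_mem : z ∉ LinearMap.range (f.baseChange (ResidueField A)) := hw
  obtain ⟨Φ, hΦ, hΦ_le⟩ := Submodule.exists_le_ker_of_notMem hz_mem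
  obtain ⟨ψ, hψ⟩ := h (Φ.restrictScalars A ∘ₗ TensorProduct.mk A (ResidueField A) M₂ 1)
    (LinearMap.ext fun m ↦ hΦ_le ⟨1 ⊗ₜ m, rfl⟩)
  have h_eq : Φ.restrictScalars A =
      (LinearMap.mul' A (ResidueField A) ∘ₗ ψ.lTensor (ResidueField A)) ∘ₗ
        g.lTensor (ResidueField A) := by
    refine TensorProduct.ext' fun a m ↦ ?_
    have hm : ψ (g m) = Φ (1 ⊗ₜ m) := LinearMap.congr_fun hψ m
    simp only [LinearMap.coe_comp, Function.comp_apply, LinearMap.lTensor_tmul,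
      LinearMap.mul'_apply, hm, LinearMap.restrictScalars_apply]
    rw [← smul_eq_mul, ← map_smul, TensorProduct.smul_tmul', smul_eq_mul, mul_one]
  refine hΦ ?_
  have := LinearMap.congr_fun h_eq z
  simpa [hz] using this

lemma subsingleton_tor_residueField [IsLocalRing A] (L : ModuleCat.{u} A) (n : ℕ)
    (h : Subsingleton (Abelian.Ext L (ModuleCat.of A (ResidueField A)) n)) :
    Subsingleton (((Tor (ModuleCat.{u} A) n).obj (ModuleCat.of A (ResidueField A))).obj L) := by
  let P := ProjectiveResolution.of L
  have h_cob (φ : P.complex.X n ⟶ ModuleCat.of A (ResidueField A))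
      (hφ : P.complex.d (n + 1) n ≫ φ = 0) :
      ∃ ψ, P.complex.d n ((ComplexShape.down ℕ).next n) ≫ ψ = φ := by
    cases n with
    | zero =>
      refine ⟨0, ?_⟩
      have h_zero : P.exact₀.desc φ hφ = 0 :=
        Abelian.Ext.homEquiv₀.symm.injective (h.elim (Abelian.Ext.homEquiv₀.symm _) _)
      rw [← P.exact₀.g_desc φ hφ, h_zero]
      exact Limits.comp_zero.trans Limits.comp_zero.symm
    | succ n =>
      rw [ChainComplex.next_nat_succ, ← P.extMk_eq_zero_iff φ (n + 2) rfl hφ n rfl]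
      exact Subsingleton.elim _ _
  let F := (MonoidalCategory.tensoringLeft (ModuleCat.{u} A)).obj (ModuleCat.of A (ResidueField A))
  have h_ex : ((F.mapHomologicalComplex _).obj P.complex).ExactAt n := by
    rw [HomologicalComplex.exactAt_iff' _ (n + 1) n _ (by simp) rfl,
      ShortComplex.moduleCat_exact_iff]
    intro z hz
    refine exists_lTensor_residueField_eq (P.complex.d (n + 1) n).hom
      (P.complex.d n ((ComplexShape.down ℕ).next n)).hom (fun φ hφ ↦ ?_) z hz
    obtain ⟨ψ, hψ⟩ := h_cob (ModuleCat.ofHom φ) (ModuleCat.hom_ext hφ)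
    exact ⟨ψ.hom, congrArg ModuleCat.Hom.hom hψ⟩
  rw [HomologicalComplex.exactAt_iff_isZero_homology] at h_ex
  exact ModuleCat.subsingleton_of_isZero (h_ex.of_iso (P.isoLeftDerivedObj F n))

end ExtVanishing

theorem depth_le_width_of_ext_vanishing (R : Type u) [CommRing R] [IsNoetherianRing R] [IsLocalRing R]
    (p : Ideal R) [p.IsPrime]
    (L : Type u) [AddCommGroup L] [Module (Localization.AtPrime p) L] [Nontrivial L]
    (hExt : ∀ T : ModuleCat.{u} (Localization.AtPrime p),
      (∃ n : ℕ, HasProjDimLE (Localization.AtPrime p) T n) →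
      ∀ i : ℕ, 0 < i →
        Subsingleton (((Ext (Localization.AtPrime p)
          (ModuleCat.{u} (Localization.AtPrime p)) i).obj (Opposite.op T)).obj
          (ModuleCat.of (Localization.AtPrime p) L))) :
    ringDepth (Localization.AtPrime p) ≤ moduleWidth (Localization.AtPrime p) L := by
  have hL (T : ModuleCat.{u} (Localization.AtPrime p))
      (hT : ∃ n, HasProjectiveDimensionLE T n) :
      Subsingleton (Abelian.Ext T (ModuleCat.of (Localization.AtPrime p) L) 1) := by
    obtain ⟨n, hn⟩ := hT
    exact subsingleton_abelianExt_of_subsingleton_ext T _ 0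
      (hExt T ⟨n, .of_hasProjectiveDimensionLE n T hn⟩ 1 one_pos)
  refine sSup_le ?_
  rintro _ ⟨rs, rfl, h_mem, h_reg⟩
  refine le_sInf ?_
  rintro _ ⟨i, rfl, hi⟩
  by_contra! hlt
  refine hi (subsingleton_tor_residueField _ i ?_)
  have hk : ∀ x ∈ rs, ∀ y : ModuleCat.of (Localization.AtPrime p)
      (ResidueField (Localization.AtPrime p)), x • y = 0 := by
    intro x hx y
    rw [Algebra.smul_def, ResidueField.algebraMap_eq, (residue_eq_zero_iff x).2 (h_mem x hx),
      zero_mul]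
  have := subsingleton_ext_linearMap_of_isWeaklyRegular _ _ hL rs hk
    (ModuleCat.of _ (Localization.AtPrime p))
    ⟨0, (projective_iff_hasProjectiveDimensionLE_zero _).1
      (ModuleCat.projective_of_free (Module.Free.chooseBasis (Localization.AtPrime p) _))⟩
    h_reg.toIsWeaklyRegular i (by exact_mod_cast hlt)
  let e := (LinearMap.ringLmapEquivSelf (Localization.AtPrime p) (Localization.AtPrime p)
    L).toModuleIso
  refine subsingleton_of_forall_eq 0 fun α ↦ ?_
  rw [← Abelian.Ext.mk₀_id_comp α, ← e.inv_hom_id, ← Abelian.Ext.mk₀_comp_mk₀_assoc,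
    Subsingleton.elim ((Abelian.Ext.mk₀ e.hom).comp α (zero_add i)) 0, Abelian.Ext.comp_zero]

end
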